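/- Fix 0 < δ < 1/2 and ε > 0. Let M ≥ 2, T ≥ 1, let A₁,…,A₄,B₁,…,B₄ ∈ [M^{−100}, M] and D ∈ [M^{−100}, M^{4−δ}], and set P = max(A₁A₂, A₃A₄, B₁B₂, B₃B₄). Let S be the set of real 8-tuples (a₁,…,a₄,b₁,…,b₄) with Aᵢ ≤ |aᵢ| ≤ 2Aᵢ and Bᵢ ≤ |bᵢ| ≤ 2Bᵢ for all i, D ≤ |Δ| ≤ 2D, and |Δ₁|, |Δ₂| ≤ M^ε(D + P/T). Then the Lebesgue measure of S satisfies vol(S) ≪_{δ,ε} (D + P/T)·M^{4 − δ/5 + ε}. -/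

import Mathlib

open MeasureTheory

noncomputable section

/-- `Δ = a₁a₂a₃a₄ - b₁b₂b₃b₄` for a real 8-tuple `x = (a, b)`. -/
def Δ₀ (x : (Fin 4 → ℝ) × (Fin 4 → ℝ)) : ℝ :=
  x.1 0 * x.1 1 * x.1 2 * x.1 3 - x.2 0 * x.2 1 * x.2 2 * x.2 3

/-- `Δ₁ = a₁a₂b₃a₄ + a₁a₂a₃b₄ - a₁b₂b₃b₄ - b₁a₂b₃b₄`. -/
def Δ₁ (x : (Fin 4 → ℝ) × (Fin 4 → ℝ)) : ℝ :=
  x.1 0 * x.1 1 * x.2 2 * x.1 3 + x.1 0 * x.1 1 * x.1 2 * x.2 3 -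
    x.1 0 * x.2 1 * x.2 2 * x.2 3 - x.2 0 * x.1 1 * x.2 2 * x.2 3

/-- `Δ₂ = a₁b₂a₃a₄ + b₁a₂a₃a₄ - b₁b₂a₃b₄ - b₁b₂b₃a₄`. -/
def Δ₂ (x : (Fin 4 → ℝ) × (Fin 4 → ℝ)) : ℝ :=
  x.1 0 * x.2 1 * x.1 2 * x.1 3 + x.2 0 * x.1 1 * x.1 2 * x.1 3 -
    x.2 0 * x.2 1 * x.1 2 * x.2 3 - x.2 0 * x.2 1 * x.2 2 * x.1 3

/-- `P = max(A₁A₂, A₃A₄, B₁B₂, B₃B₄)` built from the dyadic parameters. -/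
def Pab (A B : Fin 4 → ℝ) : ℝ :=
  max (max (A 0 * A 1) (A 2 * A 3)) (max (B 0 * B 1) (B 2 * B 3))

end

/-- A measurable set whose points have `i`-th coordinate within `r` of a function of the remaining
coordinates, the latter lying in `U`, has volume at most `2 r` times that of `U`. -/
theorem volume_le_of_abs_sub_le {n : ℕ} (i : Fin (n + 1)) {S : Set (Fin (n + 1) → ℝ)}
    (hS : MeasurableSet S) (U : Set (Fin n → ℝ)) (f : (Fin n → ℝ) → ℝ) (r : ℝ)
    (h : ∀ x ∈ S, i.removeNth x ∈ U ∧ |x i - f (i.removeNth x)| ≤ r) :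
    volume S ≤ ENNReal.ofReal (2 * r) * volume U := by
  have hmp := (volume_preserving_piFinSuccAbove (fun _ : Fin (n + 1) => ℝ) i).symm
  rw [← hmp.measure_preimage hS.nullMeasurableSet, Measure.volume_eq_prod,
    Measure.prod_apply_symm (hmp.measurable hS)]
  refine le_trans (lintegral_mono (g := U.indicator fun _ => ENNReal.ofReal (2 * r)) ?_)
    (lintegral_indicator_const_le _ _)
  intro y
  have key : ∀ t : ℝ, i.insertNth t y ∈ S → y ∈ U ∧ |t - f y| ≤ r := by
    intro t ht
    simpa using h _ ht
  by_cases hy : y ∈ U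
  · simp only [Set.indicator_of_mem hy]
    rw [← Real.volume_closedBall (f y) r]
    refine measure_mono fun t ht => ?_
    rw [Metric.mem_closedBall, Real.dist_eq]
    exact (key t ht).2
  · simp only [Set.indicator_of_notMem hy, nonpos_iff_eq_zero]
    convert measure_empty (μ := (volume : Measure ℝ))
    exact Set.eq_empty_of_forall_notMem fun t ht => hy (key t ht).1

/-- The set of vectors whose `i`-th coordinate has absolute value in `[A i, 2 * A i]`. -/
def dyadicBox {n : ℕ} (A : Fin n → ℝ) : Set (Fin n → ℝ) :=
  {x | ∀ i, A i ≤ |x i| ∧ |x i| ≤ 2 * A i}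

theorem volume_dyadicBox_le {n : ℕ} (A : Fin n → ℝ) (hA : ∀ i, 0 ≤ A i) :
    volume (dyadicBox A) ≤ ENNReal.ofReal (∏ i, 4 * A i) := by
  have hsub : dyadicBox A ⊆ Set.Icc (fun i => -(2 * A i)) (fun i => 2 * A i) := fun x hx =>
    ⟨fun i => (abs_le.1 (hx i).2).1, fun i => (abs_le.1 (hx i).2).2⟩
  refine (measure_mono hsub).trans ?_
  rw [Real.volume_Icc_pi, ENNReal.ofReal_prod_of_nonneg fun i _ => by linarith [hA i]]
  exact le_of_eq (Finset.prod_congr rfl fun i _ => by ring_nf)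

theorem isClosed_dyadicBox {n : ℕ} (A : Fin n → ℝ) : IsClosed (dyadicBox A) := by
  simp only [dyadicBox, Set.ofPred_forall, Set.ofPred_and]
  exact isClosed_iInter fun i => (isClosed_le (by fun_prop) (by fun_prop)).inter
    (isClosed_le (by fun_prop) (by fun_prop))

theorem abs_sub_div_le {c c₀ t z r : ℝ} (hc₀ : 0 < c₀) (hc : c₀ ≤ |c|) (h : |c * t - z| ≤ r) :
    |t - z / c| ≤ r / c₀ := by
  have hc' : 0 < |c| := hc₀.trans_le hc
  have hne : c ≠ 0 := abs_pos.1 hc'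
  have hr : 0 ≤ r := (abs_nonneg _).trans h
  have e : t - z / c = (c * t - z) / c := by field_simp
  rw [e, abs_div]
  gcongr

/-- Vectors in a dyadic box satisfying `|x₀ x₁ x₂ x₃ - z| ≤ r`, with the first three coordinates
restricted to a set `U`. -/
theorem volume_prod_near_le {A : Fin 4 → ℝ} (hA : ∀ i, 0 < A i) {U : Set (Fin 3 → ℝ)}
    (hU : IsClosed U) (z r : ℝ) :
    volume {x | x ∈ dyadicBox A ∧ |x 0 * x 1 * x 2 * x 3 - z| ≤ r ∧
        (Fin.last 3).removeNth x ∈ U} ≤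
      ENNReal.ofReal (2 * (r / (A 0 * A 1 * A 2))) *
        volume (dyadicBox ((Fin.last 3).removeNth A) ∩ U) := by
  refine volume_le_of_abs_sub_le (Fin.last 3) ?_ _ (fun y => z / (y 0 * y 1 * y 2)) _ ?_
  · refine IsClosed.measurableSet ?_
    have hz : IsClosed {x : Fin 4 → ℝ | |x 0 * x 1 * x 2 * x 3 - z| ≤ r} :=
      isClosed_le (by fun_prop) (by fun_prop)
    exact (isClosed_dyadicBox A).inter
      (hz.inter (hU.preimage (continuous_pi fun i => continuous_apply _)))
  · rintro x ⟨hx, hz, hxU⟩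
    refine ⟨⟨fun i => hx _, hxU⟩, ?_⟩
    refine abs_sub_div_le (c := x 0 * x 1 * x 2) (t := x 3) (mul_pos (mul_pos (hA 0) (hA 1)) (hA 2))
      ?_ hz
    rw [abs_mul, abs_mul]
    have := hA 0
    have := hA 1
    have := hA 2
    gcongr
    exacts [(hx 0).1, (hx 1).1, (hx 2).1]

theorem volume_prod_near_le_const {A : Fin 4 → ℝ} (hA : ∀ i, 0 < A i) (z : ℝ) {r : ℝ}
    (hr : 0 ≤ r) :
    volume {x | x ∈ dyadicBox A ∧ |x 0 * x 1 * x 2 * x 3 - z| ≤ r} ≤ ENNReal.ofReal (128 * r) := by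
  have h := volume_prod_near_le hA isClosed_univ z r
  simp only [Set.mem_univ, and_true, Set.inter_univ] at h
  refine h.trans ((mul_le_mul_right (volume_dyadicBox_le _ fun i => (hA _).le) _).trans ?_)
  have h0 := hA 0
  have h1 := hA 1
  have h2 := hA 2
  rw [← ENNReal.ofReal_mul (by positivity)]
  refine ENNReal.ofReal_le_ofReal (le_of_eq ?_)
  rw [Fin.prod_univ_three]
  change 2 * (r / (A 0 * A 1 * A 2)) * (4 * A 0 * (4 * A 1) * (4 * A 2)) = _
  field_simp
  ring

theorem volume_mul_near_le {A : Fin 3 → ℝ} (hA : ∀ i, 0 < A i) (i : Fin 2) (w : ℝ) {κ : ℝ}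
    (hκ : 0 ≤ κ) :
    volume (dyadicBox A ∩ {y | |y i.castSucc * y 2 - w| ≤ κ}) ≤
      ENNReal.ofReal (32 * κ * (A 0 * A 1 * A 2) / (A i.castSucc * A 2)) := by
  have h0 := hA 0
  have h1 := hA 1
  have h2 := hA 2
  have h := volume_le_of_abs_sub_le i.castSucc
    (S := dyadicBox A ∩ {y | |y i.castSucc * y 2 - w| ≤ κ})
    ((isClosed_dyadicBox A).inter (isClosed_le (by fun_prop) (by fun_prop))).measurableSet
    (dyadicBox (i.castSucc.removeNth A)) (fun y => w / y 1) (κ / A 2) (by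
      rintro x ⟨hx, hw⟩
      refine ⟨fun j => hx _, ?_⟩
      have e : i.castSucc.removeNth x 1 = x 2 := by fin_cases i <;> rfl
      rw [e]
      refine abs_sub_div_le h2 (hx 2).1 ?_
      rwa [mul_comm])
  refine h.trans ((mul_le_mul_right (volume_dyadicBox_le _ fun i => (hA _).le) _).trans ?_)
  rw [← ENNReal.ofReal_mul (by positivity)]
  refine ENNReal.ofReal_le_ofReal (le_of_eq ?_)
  rw [Fin.prod_univ_two]
  have e1 : i.castSucc.removeNth A 1 = A 2 := by fin_cases i <;> rfl
  change 2 * (κ / A 2) * (4 * i.castSucc.removeNth A 0 * (4 * i.castSucc.removeNth A 1)) = _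
  rw [e1]
  have e0 : i.castSucc.removeNth A 0 * A i.castSucc = A 0 * A 1 := by
    fin_cases i
    · exact mul_comm (A 1) (A 0)
    · rfl
  have hi := hA i.castSucc
  rw [← e0]
  field_simp
  ring

theorem volume_prod_near_mul_near_le {A : Fin 4 → ℝ} (hA : ∀ i, 0 < A i) (i : Fin 2) (z w : ℝ)
    {r κ : ℝ} (hr : 0 ≤ r) (hκ : 0 ≤ κ) :
    volume {x | x ∈ dyadicBox A ∧ |x 0 * x 1 * x 2 * x 3 - z| ≤ r ∧
        |x i.castSucc.castSucc * x 2 - w| ≤ κ} ≤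
      ENNReal.ofReal (64 * r * κ / (A i.castSucc.castSucc * A 2)) := by
  have h := volume_prod_near_le hA (U := {y | |y i.castSucc * y 2 - w| ≤ κ})
    (isClosed_le (by fun_prop) (by fun_prop)) z r
  have e : ∀ x : Fin 4 → ℝ,
      (Fin.last 3).removeNth x i.castSucc = x i.castSucc.castSucc := fun x => by
    fin_cases i <;> rfl
  have e2 : ∀ x : Fin 4 → ℝ, (Fin.last 3).removeNth x 2 = x 2 := fun x => rfl
  simp only [Set.mem_ofPred_eq, e, e2] at h
  refine h.trans ((mul_le_mul_right (volume_mul_near_le (fun j => hA _) i w hκ) _).trans ?_)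
  have h0 := hA 0
  have h1 := hA 1
  have h2 := hA 2
  rw [← ENNReal.ofReal_mul (by positivity)]
  refine ENNReal.ofReal_le_ofReal (le_of_eq ?_)
  change 2 * (r / (A 0 * A 1 * A 2)) * (32 * κ * (A 0 * A 1 * A 2) /
    ((Fin.last 3).removeNth A i.castSucc * A 2)) = _
  rw [e]
  have hi := hA i.castSucc.castSucc
  field_simp
  ring

/-- Fubini bound: fibres over points of `U` of measure at most `c`, empty elsewhere. -/
theorem volume_prod_le_of_fibre {α β : Type*} [MeasureSpace α] [MeasureSpace β]
    [SFinite (volume : Measure α)] [SFinite (volume : Measure β)] {S : Set (α × β)}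
    (hS : MeasurableSet S) (U : Set β) (c : ENNReal) (hU : ∀ x ∈ S, x.2 ∈ U)
    (hc : ∀ b ∈ U, volume {a | (a, b) ∈ S} ≤ c) : volume S ≤ c * volume U := by
  rw [Measure.volume_eq_prod, Measure.prod_apply_symm hS]
  refine le_trans (lintegral_mono (g := U.indicator fun _ => c) ?_)
    (lintegral_indicator_const_le _ _)
  intro b
  by_cases hb : b ∈ U
  · simp only [Set.indicator_of_mem hb]
    exact hc b hb
  · simp only [Set.indicator_of_notMem hb, nonpos_iff_eq_zero]
    convert measure_empty (μ := (volume : Measure α))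
    exact Set.eq_empty_of_forall_notMem fun a ha => hb (hU _ ha)

/-- On the hypersurface `Δ = 0` the condition `Δ₁ = 0` factors. -/
theorem mul_factors_eq (a b : Fin 4 → ℝ) :
    b 3 * ((a 0 * a 2 - b 0 * b 2) * (a 1 * a 2 - b 1 * b 2)) =
      a 2 * Δ₁ (a, b) - b 2 * Δ₀ (a, b) := by
  simp only [Δ₁, Δ₀]
  ring

/-- The volume is at most that of `b` times the bound from `Δ` for fixed `b`. -/
theorem volume_le_of_abs_Δ₀_le {A B : Fin 4 → ℝ} (hA : ∀ i, 0 < A i) (hB : ∀ i, 0 < B i) {D : ℝ}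
    (hD : 0 ≤ D) {S : Set ((Fin 4 → ℝ) × (Fin 4 → ℝ))} (hS : MeasurableSet S)
    (h : ∀ x ∈ S, x.1 ∈ dyadicBox A ∧ x.2 ∈ dyadicBox B ∧ |Δ₀ x| ≤ 2 * D) :
    volume S ≤ ENNReal.ofReal (65536 * D * (B 0 * B 1 * B 2 * B 3)) := by
  refine (volume_prod_le_of_fibre hS (dyadicBox B) (ENNReal.ofReal (128 * (2 * D)))
    (fun x hx => (h x hx).2.1) fun b hb => ?_).trans
    ((mul_le_mul_right (volume_dyadicBox_le B fun i => (hB i).le) _).trans ?_)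
  · refine (measure_mono fun a ha => ?_).trans
      (volume_prod_near_le_const hA (b 0 * b 1 * b 2 * b 3) (by positivity : 0 ≤ 2 * D))
    exact ⟨(h _ ha).1, (h _ ha).2.2⟩
  · rw [← ENNReal.ofReal_mul (by positivity), Fin.prod_univ_four]
    exact ENNReal.ofReal_le_ofReal (le_of_eq (by ring))

/-- The volume bound obtained by also using the factorisation `mul_factors_eq`. -/
theorem volume_le_of_factors_le {A B : Fin 4 → ℝ} (hA : ∀ i, 0 < A i) (hB : ∀ i, 0 < B i) {D K : ℝ}
    (hD : 0 ≤ D) (hK : 0 ≤ K) {S : Set ((Fin 4 → ℝ) × (Fin 4 → ℝ))} (hS : MeasurableSet S)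
    (h : ∀ x ∈ S, x.1 ∈ dyadicBox A ∧ x.2 ∈ dyadicBox B ∧ |Δ₀ x| ≤ 2 * D ∧
      B 3 ^ 2 * (|x.1 0 * x.1 2 - x.2 0 * x.2 2| * |x.1 1 * x.1 2 - x.2 1 * x.2 2|) ≤ K ^ 2) :
    volume S ≤ ENNReal.ofReal
      (32768 * D * K * (B 0 * B 1 * B 2) * (1 / (A 0 * A 2) + 1 / (A 1 * A 2))) := by
  have h0 := hA 0
  have h1 := hA 1
  have h2 := hA 2
  have h3 := hB 3
  refine (volume_prod_le_of_fibre hS (dyadicBox B)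
    (ENNReal.ofReal (64 * (2 * D) * (K / B 3) / (A 0 * A 2)) +
      ENNReal.ofReal (64 * (2 * D) * (K / B 3) / (A 1 * A 2)))
    (fun x hx => (h x hx).2.1) fun b hb => ?_).trans
    ((mul_le_mul_right (volume_dyadicBox_le B fun i => (hB i).le) _).trans ?_)
  · have hD2 : 0 ≤ 2 * D := by positivity
    have hκ : 0 ≤ K / B 3 := by positivity
    refine (measure_mono fun a ha => ?_).trans ((measure_union_le _ _).trans (add_le_add
      (volume_prod_near_mul_near_le hA 0 (b 0 * b 1 * b 2 * b 3) (b 0 * b 2) hD2 hκ)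
      (volume_prod_near_mul_near_le hA 1 (b 0 * b 1 * b 2 * b 3) (b 1 * b 2) hD2 hκ)))
    obtain ⟨ha', -, hΔ, hf⟩ := h _ ha
    have hor : |a 0 * a 2 - b 0 * b 2| ≤ K / B 3 ∨ |a 1 * a 2 - b 1 * b 2| ≤ K / B 3 := by
      by_contra! hcon
      have hlt := mul_lt_mul'' hcon.1 hcon.2 hκ hκ
      have : K ^ 2 = B 3 ^ 2 * (K / B 3 * (K / B 3)) := by field_simp
      rw [this] at hf
      exact absurd hf (not_le.2 (mul_lt_mul_of_pos_left hlt (by positivity)))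
    exact hor.imp (fun hk => ⟨ha', hΔ, hk⟩) fun hk => ⟨ha', hΔ, hk⟩
  · rw [← ENNReal.ofReal_add (by positivity) (by positivity),
      ← ENNReal.ofReal_mul (by positivity), Fin.prod_univ_four]
    refine ENNReal.ofReal_le_ofReal (le_of_eq ?_)
    field_simp
    ring

theorem Pab_le_sq {A B : Fin 4 → ℝ} {M : ℝ} (hA : ∀ i, 0 < A i ∧ A i ≤ M)
    (hB : ∀ i, 0 < B i ∧ B i ≤ M) : Pab A B ≤ M ^ 2 := by
  have hM : 0 ≤ M := (hA 0).1.le.trans (hA 0).2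
  have key : ∀ {s t : ℝ}, (0 < s ∧ s ≤ M) → (0 < t ∧ t ≤ M) → s * t ≤ M ^ 2 := fun hs ht => by
    rw [sq]
    exact mul_le_mul hs.2 ht.2 ht.1.le hM
  exact max_le (max_le (key (hA 0) (hA 1)) (key (hA 2) (hA 3)))
    (max_le (key (hB 0) (hB 1)) (key (hB 2) (hB 3)))

/-- **Volume bound (2.16).** Fix `0 < δ < 1/2` and `ε > 0`. For `M ≥ 2`, `T ≥ 1`,
dyadic parameters `Aᵢ, Bᵢ ∈ [M^{-100}, M]` and `D ∈ [M^{-100}, M^{4-δ}]`, the Lebesgue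
measure of the set `S` of real 8-tuples with `Aᵢ ≤ |aᵢ| ≤ 2Aᵢ`, `Bᵢ ≤ |bᵢ| ≤ 2Bᵢ`,
`D ≤ |Δ| ≤ 2D` and `|Δ₁|, |Δ₂| ≤ M^ε(D + P/T)` satisfies
`vol(S) ≪_{δ,ε} (D + P/T) M^{4-δ/5+ε}`. -/
theorem volume_bound (δ ε : ℝ) (hδ0 : 0 < δ) (hδ : δ < 1 / 2) (hε : 0 < ε) :
    ∃ C : ℝ, 0 < C ∧ ∀ M T : ℝ, 2 ≤ M → 1 ≤ T → ∀ A B : Fin 4 → ℝ, ∀ D : ℝ,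
      (∀ i, M ^ (-(100 : ℝ)) ≤ A i ∧ A i ≤ M ∧ M ^ (-(100 : ℝ)) ≤ B i ∧ B i ≤ M) →
      M ^ (-(100 : ℝ)) ≤ D → D ≤ M ^ (4 - δ) →
      volume {x : (Fin 4 → ℝ) × (Fin 4 → ℝ) |
          (∀ i, A i ≤ |x.1 i| ∧ |x.1 i| ≤ 2 * A i ∧ B i ≤ |x.2 i| ∧ |x.2 i| ≤ 2 * B i) ∧
          D ≤ |Δ₀ x| ∧ |Δ₀ x| ≤ 2 * D ∧
          |Δ₁ x| ≤ M ^ ε * (D + Pab A B / T) ∧ |Δ₂ x| ≤ M ^ ε * (D + Pab A B / T)}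
        ≤ ENNReal.ofReal (C * (D + Pab A B / T) * M ^ (4 - δ / 5 + ε)) := by
  refine ⟨2000000, by norm_num, fun M T hM hT A B D hAB hD hDM => ?_⟩
  have hM0 : 0 < M := by linarith
  have hM1 : 1 ≤ M := by linarith
  have hpos : 0 < M ^ (-(100 : ℝ)) := by positivity
  have hA : ∀ i, 0 < A i ∧ A i ≤ M := fun i => ⟨hpos.trans_le (hAB i).1, (hAB i).2.1⟩
  have hB : ∀ i, 0 < B i ∧ B i ≤ M := fun i =>
    ⟨hpos.trans_le (hAB i).2.2.1, (hAB i).2.2.2⟩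
  have hD0 : 0 < D := hpos.trans_le hD
  have hP0 : 0 ≤ Pab A B :=
    (mul_pos (hA 0).1 (hA 1).1).le.trans ((le_max_left _ _).trans (le_max_left _ _))
  have hPT0 : 0 ≤ Pab A B / T := by positivity
  have hPT : Pab A B / T ≤ M ^ (4 - δ) := by
    calc Pab A B / T ≤ Pab A B := div_le_self hP0 hT
      _ ≤ M ^ 2 := Pab_le_sq hA hB
      _ = M ^ (2 : ℝ) := by norm_cast
      _ ≤ M ^ (4 - δ) := Real.rpow_le_rpow_of_exponent_le hM1 (by linarith)
  set S := {x : (Fin 4 → ℝ) × (Fin 4 → ℝ) |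
          (∀ i, A i ≤ |x.1 i| ∧ |x.1 i| ≤ 2 * A i ∧ B i ≤ |x.2 i| ∧ |x.2 i| ≤ 2 * B i) ∧
          D ≤ |Δ₀ x| ∧ |Δ₀ x| ≤ 2 * D ∧
          |Δ₁ x| ≤ M ^ ε * (D + Pab A B / T) ∧ |Δ₂ x| ≤ M ^ ε * (D + Pab A B / T)} with hSdef
  have hS : MeasurableSet S := by
    have c0 : Continuous Δ₀ := by unfold Δ₀; fun_prop
    have c1 : Continuous Δ₁ := by unfold Δ₁; fun_prop
    have c2 : Continuous Δ₂ := by unfold Δ₂; fun_prop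
    measurability
  have hbox : ∀ x ∈ S, x.1 ∈ dyadicBox A ∧ x.2 ∈ dyadicBox B := fun x hx =>
    ⟨fun i => ⟨(hx.1 i).1, (hx.1 i).2.1⟩, fun i => (hx.1 i).2.2⟩
  obtain ⟨hA0, hA0M⟩ := hA 0
  obtain ⟨hA1, hA1M⟩ := hA 1
  obtain ⟨hA2, hA2M⟩ := hA 2
  obtain ⟨hA3, hA3M⟩ := hA 3
  obtain ⟨hB0, hB0M⟩ := hB 0
  obtain ⟨hB1, hB1M⟩ := hB 1
  obtain ⟨hB2, hB2M⟩ := hB 2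
  obtain ⟨hB3, hB3M⟩ := hB 3
  -- only a saving of `M ^ (δ / 5 - ε)` over `D * M ^ 4` is needed
  suffices hmain : volume S ≤ ENNReal.ofReal (2000000 * D * M ^ (4 - δ / 5 + ε)) by
    refine hmain.trans (ENNReal.ofReal_le_ofReal ?_)
    gcongr
    linarith
  by_cases hsmall : A 0 * A 1 * A 2 * A 3 ≤ M ^ (4 - δ / 5)
  · obtain hSe | ⟨x, hx⟩ := S.eq_empty_or_nonempty
    · simp [hSe]
    have hprodB : B 0 * B 1 * B 2 * B 3 ≤ 18 * M ^ (4 - δ / 5) := by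
      have hb : B 0 * B 1 * B 2 * B 3 ≤ |x.2 0 * x.2 1 * x.2 2 * x.2 3| := by
        simp only [abs_mul]
        have := (hbox x hx).2
        gcongr
        exacts [(this 0).1, (this 1).1, (this 2).1, (this 3).1]
      have ha : |x.1 0 * x.1 1 * x.1 2 * x.1 3| ≤
          2 * A 0 * (2 * A 1) * (2 * A 2) * (2 * A 3) := by
        simp only [abs_mul]
        have := (hbox x hx).1
        gcongr
        exacts [(this 0).2, (this 1).2, (this 2).2, (this 3).2]
      have hd : |x.2 0 * x.2 1 * x.2 2 * x.2 3| ≤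
          |x.1 0 * x.1 1 * x.1 2 * x.1 3| + |Δ₀ x| := by
        have := abs_sub (x.1 0 * x.1 1 * x.1 2 * x.1 3) (Δ₀ x)
        simpa [Δ₀] using this
      have hDδ : D ≤ M ^ (4 - δ / 5) :=
        hDM.trans (Real.rpow_le_rpow_of_exponent_le hM1 (by linarith))
      have := hx.2.2.1
      linarith
    refine (volume_le_of_abs_Δ₀_le (fun i => (hA i).1) (fun i => (hB i).1) hD0.le hS
      fun x hx => ⟨(hbox x hx).1, (hbox x hx).2, hx.2.2.1⟩).trans
      (ENNReal.ofReal_le_ofReal ?_)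
    calc 65536 * D * (B 0 * B 1 * B 2 * B 3) ≤ 65536 * D * (18 * M ^ (4 - δ / 5)) := by gcongr
      _ = 1179648 * D * M ^ (4 - δ / 5) := by ring
      _ ≤ 2000000 * D * M ^ (4 - δ / 5 + ε) := by
        have := Real.rpow_le_rpow_of_exponent_le hM1
          (by linarith : 4 - δ / 5 ≤ 4 - δ / 5 + ε)
        gcongr
        norm_num
  · push Not at hsmall
    have hsplit : M ^ (4 - δ / 5) = M ^ (2 - δ / 5) * M ^ 2 := by
      rw [← Real.rpow_natCast, ← Real.rpow_add hM0]
      congr 1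
      push_cast
      ring
    have hpair : ∀ {p q : ℝ}, 0 < p → 0 < q → q ≤ M ^ 2 → A 0 * A 1 * A 2 * A 3 = p * q →
        1 / p ≤ 1 / M ^ (2 - δ / 5) := fun {p q} hp hq hqM he => by
      refine one_div_le_one_div_of_le (by positivity) ?_
      rw [he, hsplit] at hsmall
      by_contra! hlt
      exact absurd hsmall (not_lt.2 (mul_le_mul hlt.le hqM hq.le (by positivity)))
    have hp02 : 1 / (A 0 * A 2) ≤ 1 / M ^ (2 - δ / 5) :=
      hpair (mul_pos hA0 hA2) (mul_pos hA1 hA3)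
        (by rw [sq]; exact mul_le_mul hA1M hA3M hA3.le hM0.le) (by ring)
    have hp12 : 1 / (A 1 * A 2) ≤ 1 / M ^ (2 - δ / 5) :=
      hpair (mul_pos hA1 hA2) (mul_pos hA0 hA3)
        (by rw [sq]; exact mul_le_mul hA0M hA3M hA3.le hM0.le) (by ring)
    set L := M ^ (3 - δ / 2 + ε / 2) with hL
    have hL0 : 0 < L := by positivity
    have hL2 : L ^ 2 = M * M * (M ^ ε * M ^ (4 - δ)) := by
      rw [hL, ← Real.rpow_natCast, ← Real.rpow_mul hM0.le, ← Real.rpow_add hM0, ← sq,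
        ← Real.rpow_natCast M, ← Real.rpow_add hM0]
      congr 1
      push_cast
      ring
    refine (volume_le_of_factors_le (fun i => (hA i).1) (fun i => (hB i).1) hD0.le
      (by positivity : 0 ≤ 4 * L) hS fun x hx =>
        ⟨(hbox x hx).1, (hbox x hx).2, hx.2.2.1, ?_⟩).trans (ENNReal.ofReal_le_ofReal ?_)
    · have hf := congrArg abs (mul_factors_eq x.1 x.2)
      rw [abs_mul, abs_mul] at hf
      have hE : M ^ ε * (D + Pab A B / T) ≤ 2 * (M ^ ε * M ^ (4 - δ)) := by
        have : M ^ ε * (D + Pab A B / T) ≤ M ^ ε * (M ^ (4 - δ) + M ^ (4 - δ)) := by gcongr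
        linarith
      have hDE : D ≤ M ^ ε * M ^ (4 - δ) :=
        hDM.trans (le_mul_of_one_le_left (by positivity) (Real.one_le_rpow hM1 hε.le))
      have hΔ₁ : |Δ₁ x| ≤ 2 * (M ^ ε * M ^ (4 - δ)) := hx.2.2.2.1.trans hE
      have hΔ₀ : |Δ₀ x| ≤ 2 * (M ^ ε * M ^ (4 - δ)) := by linarith [hx.2.2.1]
      have ha2 : |x.1 2| ≤ 2 * M := by linarith [((hbox x hx).1 2).2]
      have hb2 : |x.2 2| ≤ 2 * M := by linarith [((hbox x hx).2 2).2]
      have hb3 : B 3 ≤ |x.2 3| := ((hbox x hx).2 3).1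
      calc _ = B 3 * (B 3 * (|x.1 0 * x.1 2 - x.2 0 * x.2 2| *
              |x.1 1 * x.1 2 - x.2 1 * x.2 2|)) := by ring
        _ ≤ M * (|x.2 3| * (|x.1 0 * x.1 2 - x.2 0 * x.2 2| *
              |x.1 1 * x.1 2 - x.2 1 * x.2 2|)) := by gcongr
        _ = M * |x.1 2 * Δ₁ x - x.2 2 * Δ₀ x| := by rw [hf]
        _ ≤ M * (|x.1 2| * |Δ₁ x| + |x.2 2| * |Δ₀ x|) := by
          rw [← abs_mul, ← abs_mul]
          gcongr
          exact abs_sub _ _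
        _ ≤ M * (2 * M * (2 * (M ^ ε * M ^ (4 - δ))) + 2 * M * (2 * (M ^ ε * M ^ (4 - δ)))) := by
          gcongr
        _ = 8 * L ^ 2 := by rw [hL2]; ring
        _ ≤ (4 * L) ^ 2 := by nlinarith [sq_nonneg L]
    · calc _ ≤ 32768 * D * (4 * L) * (M * M * M) *
              (1 / M ^ (2 - δ / 5) + 1 / M ^ (2 - δ / 5)) := by
            gcongr
        _ = 262144 * D * (L * M ^ 3 / M ^ (2 - δ / 5)) := by ring
        _ = 262144 * D * M ^ (4 - 3 * δ / 10 + ε / 2) := by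
            rw [hL, ← Real.rpow_natCast M, ← Real.rpow_add hM0, ← Real.rpow_sub hM0]
            congr 2
            push_cast
            ring
        _ ≤ 2000000 * D * M ^ (4 - δ / 5 + ε) := by
            have := Real.rpow_le_rpow_of_exponent_le hM1
              (by linarith : 4 - 3 * δ / 10 + ε / 2 ≤ 4 - δ / 5 + ε)
            gcongr
            norm_num
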